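/- Assume in addition that ρ > 4λ‖A⁻¹‖. Then for every k ≥ 1 the ADMM iterates satisfy L_ρ(α¹, c¹, γ¹) ≥ L_ρ(α^k, c^k, γ^k) ≥ (λ/(2‖A⁻¹‖))·‖c^k‖² ≥ 0, and consequently the sequences (c^k)_{k≥1}, (γ^k)_{k≥1} and (α^k)_{k≥1} are all bounded. -/

import Mathlib

open Matrix

/-- The Euclidean (2-)norm on `ℝ^N`. -/
noncomputable def euclNorm {N : ℕ} (v : Fin N → ℝ) : ℝ :=
  Real.sqrt (∑ i, v i ^ 2)

/-- The operator 2-norm of an `N × N` real matrix (as an operator on Euclidean space). -/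
noncomputable def opNorm2 {N : ℕ} (M : Matrix (Fin N) (Fin N) ℝ) : ℝ :=
  ‖(Matrix.toEuclideanLin M).toContinuousLinearMap‖

/-- The augmented Lagrangian
`L_ρ(α, c, γ) = F(α) + λcᵀAc + γᵀ(α − Ac) + (ρ/2)‖α − Ac‖²`. -/
noncomputable def augLag {N : ℕ} (F : (Fin N → ℝ) → ℝ) (A : Matrix (Fin N) (Fin N) ℝ)
    (lam ρ : ℝ) (a c g : Fin N → ℝ) : ℝ :=
  F a + lam * (c ⬝ᵥ A.mulVec c) + g ⬝ᵥ (a - A.mulVec c) +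
    ρ / 2 * euclNorm (a - A.mulVec c) ^ 2

lemma euclNorm_eq_norm {N : ℕ} (v : Fin N → ℝ) : euclNorm v = ‖WithLp.toLp 2 v‖ := by
  simp [euclNorm, EuclideanSpace.norm_eq]

lemma euclNorm_nonneg {N : ℕ} (v : Fin N → ℝ) : 0 ≤ euclNorm v :=
  Real.sqrt_nonneg _

lemma euclNorm_sq {N : ℕ} (v : Fin N → ℝ) : euclNorm v ^ 2 = v ⬝ᵥ v := by
  rw [euclNorm, Real.sq_sqrt (Finset.sum_nonneg fun i _ => sq_nonneg _)]
  simp [dotProduct, sq]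

lemma euclNorm_add_le {N : ℕ} (v w : Fin N → ℝ) :
    euclNorm (v + w) ≤ euclNorm v + euclNorm w := by
  simpa only [euclNorm_eq_norm, WithLp.toLp_add] using norm_add_le _ _

lemma euclNorm_smul {N : ℕ} (r : ℝ) (v : Fin N → ℝ) :
    euclNorm (r • v) = |r| * euclNorm v := by
  simp only [euclNorm_eq_norm, WithLp.toLp_smul, norm_smul, Real.norm_eq_abs]

lemma opNorm2_nonneg {N : ℕ} (M : Matrix (Fin N) (Fin N) ℝ) : 0 ≤ opNorm2 M :=
  norm_nonneg _

lemma euclNorm_mulVec_le {N : ℕ} (M : Matrix (Fin N) (Fin N) ℝ) (v : Fin N → ℝ) :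
    euclNorm (M *ᵥ v) ≤ opNorm2 M * euclNorm v := by
  rw [euclNorm_eq_norm, euclNorm_eq_norm]
  exact (Matrix.toEuclideanLin M).toContinuousLinearMap.le_opNorm (WithLp.toLp 2 v)

lemma dotProduct_le_euclNorm_mul {N : ℕ} (v w : Fin N → ℝ) :
    v ⬝ᵥ w ≤ euclNorm v * euclNorm w := by
  have h := real_inner_le_norm (WithLp.toLp 2 w) (WithLp.toLp 2 v)
  rw [← euclNorm_eq_norm, ← euclNorm_eq_norm, mul_comm] at h
  simpa [EuclideanSpace.inner_toLp_toLp] using h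

lemma Matrix.IsSymm.dotProduct_mulVec_comm {N : ℕ} {A : Matrix (Fin N) (Fin N) ℝ}
    (hA : A.IsSymm) (v w : Fin N → ℝ) : v ⬝ᵥ A *ᵥ w = A *ᵥ v ⬝ᵥ w := by
  rw [Matrix.dotProduct_mulVec, ← Matrix.mulVec_transpose, hA.eq]

lemma Matrix.PosDef.mulVec_inv_mulVec {N : ℕ} {A : Matrix (Fin N) (Fin N) ℝ}
    (hA : A.PosDef) (v : Fin N → ℝ) : A *ᵥ (A⁻¹ *ᵥ v) = v := by
  rw [Matrix.mulVec_mulVec,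
    Matrix.mul_nonsing_inv A ((Matrix.isUnit_iff_isUnit_det A).1 hA.isUnit), Matrix.one_mulVec]

lemma Matrix.PosDef.dotProduct_mulVec_self_nonneg {N : ℕ} {A : Matrix (Fin N) (Fin N) ℝ}
    (hA : A.PosDef) (v : Fin N → ℝ) : 0 ≤ v ⬝ᵥ A *ᵥ v := by
  simpa using hA.posSemidef.dotProduct_mulVec_nonneg v

lemma Matrix.PosDef.opNorm2_inv_pos {N : ℕ} (hN : 0 < N) {A : Matrix (Fin N) (Fin N) ℝ}
    (hA : A.PosDef) : 0 < opNorm2 A⁻¹ := by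
  refine lt_of_le_of_ne (opNorm2_nonneg _) fun h0 => ?_
  have hone : euclNorm (A⁻¹ *ᵥ fun _ : Fin N => (1 : ℝ)) ≤ 0 := by
    simpa [← h0] using euclNorm_mulVec_le A⁻¹ fun _ : Fin N => (1 : ℝ)
  rw [euclNorm_eq_norm, norm_le_zero_iff, WithLp.toLp_eq_zero] at hone
  have h := hA.mulVec_inv_mulVec fun _ : Fin N => (1 : ℝ)
  rw [hone, Matrix.mulVec_zero] at h
  exact zero_ne_one (congrFun h ⟨0, hN⟩)

/-- The smallest eigenvalue of a positive definite matrix is at least `‖A⁻¹‖⁻¹`. -/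
lemma Matrix.PosDef.dotProduct_self_div_le {N : ℕ} (hN : 0 < N)
    {A : Matrix (Fin N) (Fin N) ℝ} (hsymm : A.IsSymm) (hA : A.PosDef) (v : Fin N → ℝ) :
    v ⬝ᵥ v / opNorm2 A⁻¹ ≤ v ⬝ᵥ A *ᵥ v := by
  have hm := hA.opNorm2_inv_pos hN
  set m := opNorm2 A⁻¹
  set u := A⁻¹ *ᵥ v
  have hAu : A *ᵥ u = v := hA.mulVec_inv_mulVec v
  have huv : u ⬝ᵥ v ≤ m * (v ⬝ᵥ v) := by
    rw [← euclNorm_sq v]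
    nlinarith [dotProduct_le_euclNorm_mul u v, euclNorm_nonneg v, euclNorm_mulVec_le A⁻¹ v]
  have hpos := hA.dotProduct_mulVec_self_nonneg (m • v - u)
  have hcross : u ⬝ᵥ A *ᵥ v = v ⬝ᵥ v := by
    rw [hsymm.dotProduct_mulVec_comm, hAu]
  simp only [Matrix.mulVec_sub, Matrix.mulVec_smul, hAu, sub_dotProduct, dotProduct_sub,
    smul_dotProduct, dotProduct_smul, smul_eq_mul, hcross] at hpos
  rw [div_le_iff₀ hm]
  nlinarith

/-- Second-order expansion of the augmented Lagrangian in the variable `c`. -/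
lemma augLag_add_smul {N : ℕ} (F : (Fin N → ℝ) → ℝ) {A : Matrix (Fin N) (Fin N) ℝ}
    (hA : A.IsSymm) (lam ρ : ℝ) (a c g d : Fin N → ℝ) (s : ℝ) :
    augLag F A lam ρ a (c + s • d) g = augLag F A lam ρ a c g +
      s * (A *ᵥ d ⬝ᵥ ((2 * lam) • c - (g + ρ • (a - A *ᵥ c)))) +
      s ^ 2 * (lam * (d ⬝ᵥ A *ᵥ d) + ρ / 2 * (A *ᵥ d ⬝ᵥ A *ᵥ d)) := by
  have h₁ : c ⬝ᵥ A *ᵥ d = A *ᵥ d ⬝ᵥ c := dotProduct_comm _ _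
  have h₂ : d ⬝ᵥ A *ᵥ c = A *ᵥ d ⬝ᵥ c := hA.dotProduct_mulVec_comm _ _
  have h₃ : a ⬝ᵥ A *ᵥ d = A *ᵥ d ⬝ᵥ a := dotProduct_comm _ _
  have h₄ : A *ᵥ c ⬝ᵥ A *ᵥ d = A *ᵥ d ⬝ᵥ A *ᵥ c := dotProduct_comm _ _
  have h₅ : g ⬝ᵥ A *ᵥ d = A *ᵥ d ⬝ᵥ g := dotProduct_comm _ _
  have h₆ : a ⬝ᵥ A *ᵥ c = A *ᵥ c ⬝ᵥ a := dotProduct_comm _ _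
  simp only [augLag, euclNorm_sq, Matrix.mulVec_add, Matrix.mulVec_smul, sub_dotProduct,
    dotProduct_sub, add_dotProduct, dotProduct_add, smul_dotProduct, dotProduct_smul,
    smul_eq_mul, h₁, h₂, h₃, h₄, h₅, h₆]
  ring

lemma eq_zero_of_forall_mul_add_sq_mul_nonneg {x y : ℝ}
    (h : ∀ s : ℝ, 0 ≤ s * x + s ^ 2 * y) : x = 0 := by
  have hd : discrim y x 0 ≤ 0 := discrim_le_zero fun s => by linarith [h s]
  rw [discrim] at hd
  nlinarith

/-- First-order optimality in `c`: the updated multiplier is `2λc`. -/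
lemma add_smul_eq_of_isMin_augLag {N : ℕ} {F : (Fin N → ℝ) → ℝ}
    {A : Matrix (Fin N) (Fin N) ℝ} (hsymm : A.IsSymm) (hA : A.PosDef) {lam ρ : ℝ}
    {a c g : Fin N → ℝ}
    (hc : ∀ b, augLag F A lam ρ a c g ≤ augLag F A lam ρ a b g) :
    g + ρ • (a - A *ᵥ c) = (2 * lam) • c := by
  set w := (2 * lam) • c - (g + ρ • (a - A *ᵥ c)) with hw
  have hX : A *ᵥ (A⁻¹ *ᵥ w) ⬝ᵥ w = 0 := by
    refine eq_zero_of_forall_mul_add_sq_mul_nonneg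
      (y := lam * (A⁻¹ *ᵥ w ⬝ᵥ A *ᵥ (A⁻¹ *ᵥ w)) +
        ρ / 2 * (A *ᵥ (A⁻¹ *ᵥ w) ⬝ᵥ A *ᵥ (A⁻¹ *ᵥ w))) fun s => ?_
    have h := hc (c + s • A⁻¹ *ᵥ w)
    rw [augLag_add_smul F hsymm, ← hw] at h
    linarith
  rw [hA.mulVec_inv_mulVec, dotProduct_self_eq_zero] at hX
  exact (sub_eq_zero.1 (hw.symm.trans hX)).symm

/-- Sufficient coercivity of the augmented Lagrangian when the multiplier equals `2λc`. -/
lemma add_le_augLag_two_smul {N : ℕ} (hN : 0 < N) {F : (Fin N → ℝ) → ℝ} (hF0 : ∀ v, 0 ≤ F v)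
    {A : Matrix (Fin N) (Fin N) ℝ} (hsymm : A.IsSymm) (hA : A.PosDef) {lam ρ : ℝ}
    (hlam : 0 < lam) (hρ : 4 * lam * opNorm2 A⁻¹ < ρ) (a c : Fin N → ℝ) :
    lam / (2 * opNorm2 A⁻¹) * euclNorm c ^ 2 ≤ augLag F A lam ρ a c ((2 * lam) • c) ∧
      ρ / 4 * euclNorm (a - A *ᵥ c) ^ 2 ≤ augLag F A lam ρ a c ((2 * lam) • c) := by
  have hm := hA.opNorm2_inv_pos hN
  have hcoer := hA.dotProduct_self_div_le hN hsymm c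
  rw [← euclNorm_sq] at hcoer
  set m := opNorm2 A⁻¹
  set r := a - A *ᵥ c
  have hFa := hF0 a
  have hcr : -(c ⬝ᵥ r) ≤ euclNorm c * euclNorm r := by
    have h := dotProduct_le_euclNorm_mul (-c) r
    rw [neg_dotProduct] at h
    have hneg : euclNorm (-c) = euclNorm c := by simp [euclNorm]
    rwa [hneg] at h
  have hL : augLag F A lam ρ a c ((2 * lam) • c) =
      F a + lam * (c ⬝ᵥ A *ᵥ c) + 2 * lam * (c ⬝ᵥ r) + ρ / 2 * euclNorm r ^ 2 := by
    rw [augLag, smul_dotProduct, smul_eq_mul]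
  rw [hL]
  set x := euclNorm c
  set y := euclNorm r
  have hcr' := mul_le_mul_of_nonneg_left hcr hlam.le
  have hcoer' := mul_le_mul_of_nonneg_left hcoer hlam.le
  have hy : 4 * lam * m * y ^ 2 ≤ ρ * y ^ 2 := by gcongr
  have e₁ : lam / (2 * m) * x ^ 2 = lam * (x ^ 2 / m) / 2 := by field_simp
  have hyoung : ∀ t : ℝ, 0 < t → 2 * x * y ≤ t * (x ^ 2 / m) + m * y ^ 2 / t := by
    intro t ht
    have h : t * (x ^ 2 / m) + m * y ^ 2 / t - 2 * x * y = (t * x - m * y) ^ 2 / (t * m) := by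
      field_simp
      ring
    have hnonneg : 0 ≤ (t * x - m * y) ^ 2 / (t * m) := by positivity
    linarith
  constructor
  · have h := mul_le_mul_of_nonneg_left (hyoung (1 / 2) (by norm_num)) hlam.le
    rw [e₁]
    nlinarith
  · have h := mul_le_mul_of_nonneg_left (hyoung 1 one_pos) hlam.le
    nlinarith

/-- An ADMM sweep starting from a multiplier equal to `2λc` decreases the augmented
Lagrangian. -/
lemma augLag_admm_step_le {N : ℕ} (hN : 0 < N) {F : (Fin N → ℝ) → ℝ}
    {A : Matrix (Fin N) (Fin N) ℝ} (hsymm : A.IsSymm) (hA : A.PosDef) {lam ρ : ℝ}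
    (hlam : 0 < lam) (hρ0 : 0 < ρ) (hρ : 4 * lam * opNorm2 A⁻¹ < ρ) {a a' c c' : Fin N → ℝ}
    (ha : augLag F A lam ρ a' c ((2 * lam) • c) ≤ augLag F A lam ρ a c ((2 * lam) • c))
    (hc : (2 * lam) • c + ρ • (a' - A *ᵥ c') = (2 * lam) • c') :
    augLag F A lam ρ a' c' ((2 * lam) • c') ≤ augLag F A lam ρ a c ((2 * lam) • c) := by
  refine le_trans ?_ ha
  have hm := hA.opNorm2_inv_pos hN
  set d := c - c' with hd
  have hcoer := hA.dotProduct_self_div_le hN hsymm d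
  have hexp := augLag_add_smul F hsymm lam ρ a' c' ((2 * lam) • c) d 1
  rw [hc, sub_self, dotProduct_zero, one_smul, hd, add_sub_cancel, ← hd] at hexp
  have hAd : 0 ≤ A *ᵥ d ⬝ᵥ A *ᵥ d := by
    rw [← euclNorm_sq]
    positivity
  have hr : a' - A *ᵥ c' = (-(2 * lam / ρ)) • d := by
    have h : ρ • (a' - A *ᵥ c') = (-(2 * lam)) • d := by
      rw [eq_sub_of_add_eq' hc, hd]
      module
    rw [← inv_smul_smul₀ hρ0.ne' (a' - A *ᵥ c'), h, smul_smul]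
    congr 1
    ring
  have hdual : augLag F A lam ρ a' c' ((2 * lam) • c') =
      augLag F A lam ρ a' c' ((2 * lam) • c) + 4 * lam ^ 2 / ρ * (d ⬝ᵥ d) := by
    have hcc : c' = c - d := by rw [hd, sub_sub_cancel]
    have h : ((2 * lam) • c') ⬝ᵥ (a' - A *ᵥ c') =
        ((2 * lam) • c) ⬝ᵥ (a' - A *ᵥ c') + 4 * lam ^ 2 / ρ * (d ⬝ᵥ d) := by
      rw [hr, hcc]
      simp only [smul_dotProduct, dotProduct_smul, sub_dotProduct, smul_eq_mul]
      ring
    rw [augLag, augLag, h]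
    ring
  have hcoef : 4 * lam ^ 2 / ρ * (d ⬝ᵥ d) ≤ lam * (d ⬝ᵥ d / opNorm2 A⁻¹) := by
    have hdd : 0 ≤ d ⬝ᵥ d := by
      rw [← euclNorm_sq]
      positivity
    have h : 4 * lam ^ 2 / ρ ≤ lam / opNorm2 A⁻¹ := by
      rw [div_le_div_iff₀ hρ0 hm]
      nlinarith
    calc _ ≤ lam / opNorm2 A⁻¹ * (d ⬝ᵥ d) := by gcongr
      _ = _ := by ring
  have hcoer' := mul_le_mul_of_nonneg_left hcoer hlam.le
  have hquad : 0 ≤ ρ / 2 * (A *ᵥ d ⬝ᵥ A *ᵥ d) := by positivity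
  linarith

/-- **Boundedness of the ADMM iterates (estimate (4.7))**: if `ρ > 4λ‖A⁻¹‖`, then for all
`k ≥ 1`, `L_ρ(α¹, c¹, γ¹) ≥ L_ρ(α^k, c^k, γ^k) ≥ (λ/(2‖A⁻¹‖))‖c^k‖² ≥ 0`, and the
sequences `(c^k)`, `(γ^k)`, `(α^k)` are bounded. -/
theorem admm_iterates_bounded
    (N : ℕ) (hN : 0 < N) (A : Matrix (Fin N) (Fin N) ℝ)
    (hAsymm : A.IsSymm) (hA : A.PosDef)
    (lam ρ : ℝ) (hlam : 0 < lam) (hρ : 0 < ρ)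
    (F : (Fin N → ℝ) → ℝ) (hF0 : ∀ v, 0 ≤ F v) (hFlsc : LowerSemicontinuous F)
    (α c γ : ℕ → Fin N → ℝ)
    (hα : ∀ k, ∀ a : Fin N → ℝ,
      augLag F A lam ρ (α (k+1)) (c k) (γ k) ≤ augLag F A lam ρ a (c k) (γ k))
    (hc : ∀ k, ∀ b : Fin N → ℝ,
      augLag F A lam ρ (α (k+1)) (c (k+1)) (γ k) ≤ augLag F A lam ρ (α (k+1)) b (γ k))
    (hγ : ∀ k, γ (k+1) = γ k + ρ • (α (k+1) - A.mulVec (c (k+1))))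
    (hρbig : 4 * lam * opNorm2 A⁻¹ < ρ) :
    (∀ k : ℕ, 1 ≤ k →
      augLag F A lam ρ (α k) (c k) (γ k) ≤ augLag F A lam ρ (α 1) (c 1) (γ 1) ∧
      lam / (2 * opNorm2 A⁻¹) * euclNorm (c k) ^ 2 ≤
        augLag F A lam ρ (α k) (c k) (γ k) ∧
      0 ≤ lam / (2 * opNorm2 A⁻¹) * euclNorm (c k) ^ 2) ∧
    ∃ M : ℝ, ∀ k : ℕ, 1 ≤ k →
      euclNorm (c k) ≤ M ∧ euclNorm (γ k) ≤ M ∧ euclNorm (α k) ≤ M := by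
  have hm := hA.opNorm2_inv_pos hN
  have hmult : ∀ k, γ (k + 1) = (2 * lam) • c (k + 1) := fun k =>
    (hγ k).trans (add_smul_eq_of_isMin_augLag hAsymm hA (hc k))
  have hdesc : ∀ k, augLag F A lam ρ (α (k + 1)) (c (k + 1)) (γ (k + 1)) ≤
      augLag F A lam ρ (α 1) (c 1) (γ 1) := by
    intro k
    induction k with
    | zero => exact le_rfl
    | succ k ih =>
      refine le_trans ?_ ih
      have ha := hα (k + 1) (α (k + 1))
      have hstep := (hγ (k + 1)).symm
      rw [hmult k] at ha hstep ⊢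
      rw [hmult (k + 1)] at hstep ⊢
      exact augLag_admm_step_le hN hAsymm hA hlam hρ hρbig ha hstep
  set L₁ := augLag F A lam ρ (α 1) (c 1) (γ 1)
  have hlow : ∀ k, lam / (2 * opNorm2 A⁻¹) * euclNorm (c (k + 1)) ^ 2 ≤
        augLag F A lam ρ (α (k + 1)) (c (k + 1)) (γ (k + 1)) ∧
      ρ / 4 * euclNorm (α (k + 1) - A *ᵥ c (k + 1)) ^ 2 ≤
        augLag F A lam ρ (α (k + 1)) (c (k + 1)) (γ (k + 1)) := by
    intro k
    rw [hmult k]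
    exact add_le_augLag_two_smul hN hF0 hAsymm hA hlam hρbig _ _
  refine ⟨fun k hk => ?_, ?_⟩
  · obtain ⟨k, rfl⟩ := Nat.exists_eq_add_of_le' hk
    exact ⟨hdesc k, (hlow k).1, by positivity⟩
  set C := Real.sqrt (L₁ / (lam / (2 * opNorm2 A⁻¹)))
  set R := Real.sqrt (L₁ / (ρ / 4))
  refine ⟨max C (max (2 * lam * C) (R + opNorm2 A * C)), fun k hk => ?_⟩
  obtain ⟨k, rfl⟩ := Nat.exists_eq_add_of_le' hk
  have hcC : euclNorm (c (k + 1)) ≤ C := by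
    refine Real.le_sqrt_of_sq_le ?_
    rw [le_div_iff₀' (by positivity)]
    exact (hlow k).1.trans (hdesc k)
  have hrR : euclNorm (α (k + 1) - A *ᵥ c (k + 1)) ≤ R := by
    refine Real.le_sqrt_of_sq_le ?_
    rw [le_div_iff₀' (by positivity)]
    exact (hlow k).2.trans (hdesc k)
  refine ⟨le_max_of_le_left hcC, le_max_of_le_right (le_max_of_le_left ?_),
    le_max_of_le_right (le_max_of_le_right ?_)⟩
  · rw [hmult k, euclNorm_smul, abs_of_pos (by positivity)]
    gcongr
  · calc euclNorm (α (k + 1))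
        = euclNorm ((α (k + 1) - A *ᵥ c (k + 1)) + A *ᵥ c (k + 1)) := by rw [sub_add_cancel]
      _ ≤ euclNorm (α (k + 1) - A *ᵥ c (k + 1)) + euclNorm (A *ᵥ c (k + 1)) :=
        euclNorm_add_le _ _
      _ ≤ R + opNorm2 A * C := by
        refine add_le_add hrR ((euclNorm_mulVec_le _ _).trans ?_)
        exact mul_le_mul_of_nonneg_left hcC (opNorm2_nonneg A)
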